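/- Let μ > 0, γ > 0 with 2γ < √μ, and let x ∈ ℝ. Then the function J : ℝ → ℝ defined by J(u) = (x − u)²/(2μ) + log((γ² + u²)/γ) is not convex on ℝ; in particular there exists u ∈ ℝ with 1/μ + (2γ² − 2u²)/(u² + γ²)² < 0. -/

import Mathlib

theorem ConvexOn.nonneg_of_hasDerivAt_hasDerivAt {f f' : ℝ → ℝ} {c u : ℝ}
    (hf : ConvexOn ℝ Set.univ f) (hf' : ∀ v, HasDerivAt f (f' v) v) (hc : HasDerivAt f' c u) :
    0 ≤ c := by
  have hmono : Monotone f' := by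
    have hderiv : deriv f = f' := funext fun v => (hf' v).deriv
    rw [← hderiv, ← monotoneOn_univ]
    exact hf.monotoneOn_deriv fun v _ => (hf' v).differentiableAt
  rw [← hc.deriv]
  exact hmono.deriv_nonneg

theorem hasDerivAt_cauchy_prox_cost {γ : ℝ} (hγ : 0 < γ) (μ x u : ℝ) :
    HasDerivAt (fun u : ℝ => (x - u) ^ 2 / (2 * μ) + Real.log ((γ ^ 2 + u ^ 2) / γ))
      ((u - x) / μ + 2 * u / (u ^ 2 + γ ^ 2)) u := by
  have hpos : 0 < γ ^ 2 + u ^ 2 := by positivity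
  have hquad := (((hasDerivAt_id u).const_sub x).pow 2).div_const (2 * μ)
  have hlog := ((((hasDerivAt_id u).pow 2).const_add (γ ^ 2)).div_const γ).log
    (div_pos hpos hγ).ne'
  refine (hquad.add hlog).congr_deriv ?_
  rw [add_comm (u ^ 2)]
  congr 1
  · rw [← mul_div_mul_left (u - x) μ two_ne_zero]
    simp only [id]
    ring
  · simp only [id, Pi.pow_apply]
    field_simp
    simp [mul_comm]

theorem hasDerivAt_deriv_cauchy_prox_cost {γ : ℝ} (hγ : 0 < γ) (μ x u : ℝ) :
    HasDerivAt (fun u : ℝ => (u - x) / μ + 2 * u / (u ^ 2 + γ ^ 2))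
      (1 / μ + (2 * γ ^ 2 - 2 * u ^ 2) / (u ^ 2 + γ ^ 2) ^ 2) u := by
  have hpos : 0 < u ^ 2 + γ ^ 2 := by positivity
  have hlin := ((hasDerivAt_id u).sub_const x).div_const μ
  have hfrac := ((hasDerivAt_id u).const_mul 2).div
    (((hasDerivAt_id u).pow 2).add_const (γ ^ 2)) hpos.ne'
  refine (hlin.add hfrac).congr_deriv ?_
  congr 2
  simp only [id, Pi.pow_apply]
  norm_num
  ring

theorem exists_deriv2_cauchy_prox_cost_neg {μ γ : ℝ} (hγ : 0 < γ)
    (hcond : 2 * γ < Real.sqrt μ) :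
    ∃ u : ℝ, 1 / μ + (2 * γ ^ 2 - 2 * u ^ 2) / (u ^ 2 + γ ^ 2) ^ 2 < 0 := by
  refine ⟨Real.sqrt 3 * γ, ?_⟩
  have hlt : 4 * γ ^ 2 < μ := by
    have h := (Real.lt_sqrt (by positivity)).1 hcond
    linarith [mul_pow 2 γ 2]
  have hval : (2 * γ ^ 2 - 2 * (Real.sqrt 3 * γ) ^ 2) / ((Real.sqrt 3 * γ) ^ 2 + γ ^ 2) ^ 2
      = -(1 / (4 * γ ^ 2)) := by
    rw [mul_pow, Real.sq_sqrt (by norm_num)]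
    field_simp
    ring
  rw [hval]
  linarith [one_div_lt_one_div_of_lt (by positivity) hlt]

theorem cauchy_prox_cost_not_convex (μ γ : ℝ) (hμ : 0 < μ) (hγ : 0 < γ)
    (hcond : 2 * γ < Real.sqrt μ) (x : ℝ) :
    ¬ ConvexOn ℝ Set.univ
        (fun u : ℝ => (x - u) ^ 2 / (2 * μ) + Real.log ((γ ^ 2 + u ^ 2) / γ)) ∧
    ∃ u : ℝ, 1 / μ + (2 * γ ^ 2 - 2 * u ^ 2) / (u ^ 2 + γ ^ 2) ^ 2 < 0 := by
  obtain ⟨u, hu⟩ := exists_deriv2_cauchy_prox_cost_neg hγ hcond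
  refine ⟨fun hconv => hu.not_ge ?_, u, hu⟩
  exact hconv.nonneg_of_hasDerivAt_hasDerivAt (hasDerivAt_cauchy_prox_cost hγ μ x)
    (hasDerivAt_deriv_cauchy_prox_cost hγ μ x u)
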